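/- arXiv:1310.7716 — 2 statements merged into one kernel-verified Lean document; each statement's English description precedes it below -/
import Mathlib

section
/- Let r ≥ 1, A ∈ GL_r(ℝ), x, y ∈ (0,1)^r, and let G : ℂ^r → ℂ be any holomorphic function on all of ℂ^r satisfying G(s) = L(s, A, x, y) whenever Re s_ν > 0 for all ν. Then for every k ∈ ℤ_{≥0}^r one has G(−k) = B_k(A, x, y). -/
open MeasureTheory

noncomputable section

/-- `e z = exp (2 π i z)` -/
def eC (z : ℂ) : ℂ := Complex.exp (2 * Real.pi * Complex.I * z)

/-- `φ(t,x,y) = e(itx)/(1 - e(y + it))` -/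
def phiF (t x y : ℝ) : ℂ := eC (Complex.I * t * x) / (1 - eC (y + Complex.I * t))

/-- `F(t,x,y) = ∏_ν φ(t_ν, x_ν, y_ν)` -/
def FF {r : ℕ} (t x y : Fin r → ℝ) : ℂ := ∏ ν, phiF (t ν) (x ν) (y ν)

/-- `Γ_ℝ(s) = π^(-s/2) Γ(s/2)` -/
def GammaR (s : ℂ) : ℂ := (Real.pi : ℂ) ^ (-s / 2) * Complex.Gamma (s / 2)

/-- `Γ_ℂ(s) = 2 (2π)^(-s) Γ(s)` -/
def GammaC (s : ℂ) : ℂ := 2 * (2 * (Real.pi : ℂ)) ^ (-s) * Complex.Gamma s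

/-- the quasi-character `|t|_χ^s = ∏_ν sgn(t_ν)^{χ(ν)} |t_ν|^{s_ν}` -/
def qchar {r : ℕ} (χ : Fin r → ℕ) (s : Fin r → ℂ) (t : Fin r → ℝ) : ℂ :=
  ∏ ν, ((Real.sign (t ν) : ℂ)) ^ (χ ν) * ((|t ν| : ℝ) : ℂ) ^ (s ν)

/-- the Shintani L-function, defined by the integral representation
`L(s,A,x,y) = 2^r (∏ Γ_ℂ(s_ν))⁻¹ ∫_{(0,∞)^r} F(tA,x,y) t^s ∏ dt_ν/t_ν` -/
def ShintaniL {r : ℕ} (s : Fin r → ℂ) (A : Matrix (Fin r) (Fin r) ℝ)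
    (x y : Fin r → ℝ) : ℂ :=
  2 ^ r * (∏ ν, GammaC (s ν))⁻¹ *
    ∫ t in Set.univ.pi fun _ : Fin r => Set.Ioi (0 : ℝ),
      FF (Matrix.vecMul t A) x y * ∏ ν, (((t ν : ℝ) : ℂ) ^ (s ν) * ((t ν : ℝ) : ℂ)⁻¹)

/-- the normalized Shintani L-function of parity type χ,
`L_χ(s,A,x,y) = (∏ Γ_ℂ(s_ν))⁻¹ ∫_{(ℝ^×)^r} F(tA,x,y) |t|_χ^s ∏ dt_ν/t_ν` -/
def ShintaniLchi {r : ℕ} (χ : Fin r → ℕ) (s : Fin r → ℂ)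
    (A : Matrix (Fin r) (Fin r) ℝ) (x y : Fin r → ℝ) : ℂ :=
  (∏ ν, GammaC (s ν))⁻¹ *
    ∫ t : Fin r → ℝ,
      FF (Matrix.vecMul t A) x y * qchar χ s t * ∏ ν, ((t ν : ℝ) : ℂ)⁻¹

/-- `Γ_χ(s) = ∏_ν Γ_ℝ(s_ν + χ(ν))` -/
def GammaChi {r : ℕ} (χ : Fin r → ℕ) (s : Fin r → ℂ) : ℂ :=
  ∏ ν, GammaR (s ν + (χ ν : ℂ))

/-- the completed normalized Shintani L-function
`L̂_χ(s,A,x,y) = |det A|^{1/2} Γ_χ(s) L_χ(s,A,x,y)` -/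
def ShintaniLhat {r : ℕ} (χ : Fin r → ℕ) (s : Fin r → ℂ)
    (A : Matrix (Fin r) (Fin r) ℝ) (x y : Fin r → ℝ) : ℂ :=
  ((Real.sqrt |A.det| : ℝ) : ℂ) * GammaChi χ s * ShintaniLchi χ s A x y


/-- the partial derivative in the ν-th coordinate -/
def pder {r : ℕ} (ν : Fin r) (g : (Fin r → ℝ) → ℂ) : (Fin r → ℝ) → ℂ :=
  fun t => deriv (fun u : ℝ => g (Function.update t ν u)) (t ν)

/-- the iterated partial derivative `∂_{t_1}^{k_1} ⋯ ∂_{t_r}^{k_r}` -/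
def pderMulti {r : ℕ} (k : Fin r → ℕ) (g : (Fin r → ℝ) → ℂ) : (Fin r → ℝ) → ℂ :=
  (List.finRange r).foldr (fun ν h => (pder ν)^[k ν] h) g

/-- the multiple Bernoulli-like numbers
`B_k(A,x,y) = (-2π)^{-(k_1+⋯+k_r)} ∂^k F(tA,x,y)|_{t=0}` -/
def BkNum {r : ℕ} (A : Matrix (Fin r) (Fin r) ℝ) (x y : Fin r → ℝ)
    (k : Fin r → ℕ) : ℂ :=
  ((-2 * (Real.pi : ℂ)) ^ (∑ ν, k ν))⁻¹ *
    pderMulti k (fun t => FF (Matrix.vecMul t A) x y) 0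

section ShintaniHelpers

open Set Filter Topology

/-- basic one-variable building block -/
def qfun (w : ℂ) (a : ℝ) (m : ℕ) (t : ℝ) : ℂ :=
  Complex.exp (-(a * t : ℝ)) * ((1 - w * Complex.exp (-(2 * Real.pi * t : ℝ))) ^ m)⁻¹

/-- one-variable class of functions -/
inductive EClass : (ℝ → ℂ) → Prop
  | gen (w : ℂ) (hw : ‖w‖ = 1) (hw1 : w ≠ 1) (a : ℝ) (m : ℕ) (h0 : 0 < a)
      (h1 : a < m * (2 * Real.pi)) : EClass (qfun w a m)
  | add (f g : ℝ → ℂ) : EClass f → EClass g → EClass (fun t => f t + g t)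
  | smul (c : ℂ) (f : ℝ → ℂ) : EClass f → EClass (fun t => c * f t)

lemma norm_one_sub_ge (w : ℂ) (hw : ‖w‖ = 1) (hw1 : w ≠ 1) :
    ∃ κ : ℝ, 0 < κ ∧ ∀ R : ℝ, 0 ≤ R → κ * (1 + R) ≤ ‖1 - w * (R : ℂ)‖ := by
  have hn : w.re * w.re + w.im * w.im = 1 := by
    have := Complex.normSq_apply w
    rw [Complex.normSq_eq_norm_sq, hw] at this
    linarith
  have hre : w.re < 1 := by
    rcases lt_or_ge w.re 1 with h | h
    · exact h
    · exfalso
      have h2 : w.re = 1 := by nlinarith [mul_self_nonneg w.im]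
      have h3 : w.im = 0 := by
        rw [h2] at hn; simpa using hn
      exact hw1 (Complex.ext h2 h3)
  refine ⟨Real.sqrt ((1 - w.re) / 2), Real.sqrt_pos.mpr (by linarith), fun R hR => ?_⟩
  apply le_of_sq_le_sq _ (norm_nonneg _)
  rw [mul_pow, Real.sq_sqrt (by linarith), ← Complex.normSq_eq_norm_sq, Complex.normSq_apply]
  simp
  have : 0 ≤ (1 + w.re) * (1 - R) ^ 2 := by
    apply mul_nonneg _ (sq_nonneg _)
    nlinarith [mul_self_nonneg w.im]
  have h4 : w.im * w.im = 1 - w.re * w.re := by linarith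
  have : (w.im * R) * (w.im * R) = (1 - w.re * w.re) * R ^ 2 := by rw [← h4]; ring
  nlinarith

lemma den_ne (w : ℂ) (hw : ‖w‖ = 1) (hw1 : w ≠ 1) (t : ℝ) :
    1 - w * Complex.exp (-(2 * Real.pi * t : ℝ)) ≠ 0 := by
  obtain ⟨κ, hκ, h⟩ := norm_one_sub_ge w hw hw1
  have := h (Real.exp (-(2 * Real.pi * t))) (Real.exp_pos _).le
  intro h0
  rw [Complex.ofReal_exp, Complex.ofReal_neg] at this
  rw [h0, norm_zero] at this
  have := mul_pos hκ (add_pos one_pos (Real.exp_pos (-(2 * Real.pi * t))))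
  linarith

lemma qfun_hasDerivAt (w : ℂ) (hw : ‖w‖ = 1) (hw1 : w ≠ 1) (a : ℝ) (m : ℕ) (t : ℝ) :
    HasDerivAt (qfun w a m)
      ((-(a : ℂ)) * qfun w a m t +
        (-(m * w * (2 * Real.pi))) * qfun w (a + 2 * Real.pi) (m + 1) t) t := by
  have hd := den_ne w hw hw1 t
  have he : ∀ b : ℝ, HasDerivAt (fun t : ℝ => Complex.exp (-(b * t : ℝ)))
      (-(b : ℂ) * Complex.exp (-(b * t : ℝ))) t := by
    intro b
    have h1 : HasDerivAt (fun t : ℝ => (-(b * t : ℝ) : ℂ)) (-(b : ℂ)) t := by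
      have : HasDerivAt (fun t : ℝ => -(b * t)) (-b) t := by
        simpa using ((hasDerivAt_id t).const_mul b).fun_neg
      simpa using this.ofReal_comp
    simpa [mul_comm] using h1.cexp
  have hD : HasDerivAt (fun t : ℝ => 1 - w * Complex.exp (-(2 * Real.pi * t : ℝ)))
      (w * (2 * Real.pi) * Complex.exp (-(2 * Real.pi * t : ℝ))) t := by
    have := ((he (2 * Real.pi)).const_mul w).const_sub 1
    convert! this using 1
    push_cast; ring
  have hP := (hD.fun_pow m).fun_inv (pow_ne_zero m hd)
  convert! (he a).mul hP using 1
  unfold qfun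
  have hs : Complex.exp (-((a + 2 * Real.pi) * t : ℝ)) =
      Complex.exp (-(a * t : ℝ)) * Complex.exp (-(2 * Real.pi * t : ℝ)) := by
    rw [← Complex.exp_add]; congr 1; push_cast; ring
  rw [hs]
  generalize Complex.exp (-(a * t : ℝ)) = X at *
  generalize Complex.exp (-(2 * Real.pi * t : ℝ)) = Y at *
  rcases m with _ | m
  · simp
  · simp only [Nat.add_sub_cancel]
    field_simp
    push_cast
    ring

lemma qfun_bound (w : ℂ) (hw : ‖w‖ = 1) (hw1 : w ≠ 1) (a : ℝ) (m : ℕ) (h0 : 0 < a)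
      (h1 : a < m * (2 * Real.pi)) :
    ∃ C c : ℝ, 0 < c ∧ ∀ t, ‖qfun w a m t‖ ≤ C * Real.exp (-(c * |t|)) := by
  obtain ⟨κ, hκ, h⟩ := norm_one_sub_ge w hw hw1
  refine ⟨(κ ^ m)⁻¹, min a (m * (2 * Real.pi) - a), lt_min h0 (by linarith), fun t => ?_⟩
  set c := min a (m * (2 * Real.pi) - a) with hc
  have hca : c ≤ a := min_le_left _ _
  have hcb : c ≤ m * (2 * Real.pi) - a := min_le_right _ _
  have hh := h (Real.exp (-(2 * Real.pi * t))) (Real.exp_pos _).le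
  rw [Complex.ofReal_exp, Complex.ofReal_neg] at hh
  have hE := Real.exp_pos (-(2 * Real.pi * t))
  unfold qfun
  rw [norm_mul, norm_inv, norm_pow, ← Complex.ofReal_neg (a * t), ← Complex.ofReal_exp, Complex.norm_real,
    Real.norm_of_nonneg (Real.exp_pos _).le]
  have hge : (κ * (1 + Real.exp (-(2 * Real.pi * t)))) ^ m ≤
      ‖1 - w * Complex.exp (-(2 * Real.pi * t : ℝ))‖ ^ m := pow_le_pow_left₀ (by positivity) hh m
  have hk : 0 < κ ^ m := pow_pos hκ m
  have h2 : Real.exp (-(a * t)) ≤ Real.exp (-(c * |t|)) * (1 + Real.exp (-(2 * Real.pi * t))) ^ m := by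
    rcases le_total 0 t with ht | ht
    · rw [abs_of_nonneg ht]
      have : Real.exp (-(a * t)) ≤ Real.exp (-(c * t)) := Real.exp_le_exp.mpr (by nlinarith)
      have h3 : 1 ≤ (1 + Real.exp (-(2 * Real.pi * t))) ^ m := one_le_pow₀ (by linarith)
      nlinarith [Real.exp_pos (-(c * t))]
    · rw [abs_of_nonpos ht]
      have h3 : Real.exp (-(2 * Real.pi * t)) ^ m ≤ (1 + Real.exp (-(2 * Real.pi * t))) ^ m :=
        pow_le_pow_left₀ hE.le (by linarith) m
      rw [← Real.exp_nat_mul] at h3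
      calc Real.exp (-(a * t)) ≤ Real.exp (-(c * -t)) * Real.exp (m * -(2 * Real.pi * t)) := by
            rw [← Real.exp_add]; apply Real.exp_le_exp.mpr; nlinarith
        _ ≤ _ := mul_le_mul_of_nonneg_left h3 (Real.exp_pos _).le
  rw [mul_pow] at hge
  have hpos : 0 < ‖1 - w * Complex.exp (-(2 * Real.pi * t : ℝ))‖ ^ m := lt_of_lt_of_le (by positivity) hge
  rw [← div_eq_mul_inv, div_le_iff₀ hpos]
  calc _ ≤ _ := h2
    _ = (κ ^ m)⁻¹ * Real.exp (-(c * |t|)) * (κ ^ m * (1 + Real.exp (-(2 * Real.pi * t))) ^ m) := by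
      field_simp
    _ ≤ _ := mul_le_mul_of_nonneg_left hge (by positivity)

lemma EClass.differentiable {f : ℝ → ℂ} (hf : EClass f) :
    Differentiable ℝ f ∧ EClass (deriv f) := by
  induction hf with
  | gen w hw hw1 a m h0 h1 =>
    refine ⟨fun t => (qfun_hasDerivAt w hw hw1 a m t).differentiableAt, ?_⟩
    have : deriv (qfun w a m) = fun t => ((-(a : ℂ)) * qfun w a m t +
        (-(m * w * (2 * Real.pi))) * qfun w (a + 2 * Real.pi) (m + 1) t) :=
      funext fun t => (qfun_hasDerivAt w hw hw1 a m t).deriv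
    rw [this]
    refine .add _ _ (.smul _ _ (.gen w hw hw1 a m h0 h1))
      (.smul _ _ (.gen w hw hw1 _ _ (by positivity) ?_))
    push_cast; linarith
  | add f g _ _ hf hg =>
    refine ⟨hf.1.fun_add hg.1, ?_⟩
    have : deriv (fun t => f t + g t) = fun t => deriv f t + deriv g t :=
      funext fun t => deriv_fun_add (hf.1 t) (hg.1 t)
    rw [this]; exact .add _ _ hf.2 hg.2
  | smul c f _ hf =>
    refine ⟨hf.1.const_mul c, ?_⟩
    have : deriv (fun t => c * f t) = fun t => c * deriv f t :=
      funext fun t => deriv_const_mul c (hf.1 t)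
    rw [this]; exact .smul _ _ hf.2

lemma exp_bound_mono {C c C' c' t : ℝ} (hC : C ≤ C') (hC' : 0 ≤ C') (hc : c' ≤ c) (ht : 0 ≤ t) :
    C * Real.exp (-(c * t)) ≤ C' * Real.exp (-(c' * t)) := by
  apply mul_le_mul hC _ (Real.exp_pos _).le hC'
  apply Real.exp_le_exp.mpr; nlinarith

lemma EClass.bound {f : ℝ → ℂ} (hf : EClass f) :
    ∃ C c : ℝ, 0 < c ∧ ∀ t, ‖f t‖ ≤ C * Real.exp (-(c * |t|)) := by
  induction hf with
  | gen w hw hw1 a m h0 h1 => exact qfun_bound w hw hw1 a m h0 h1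
  | add f g _ _ hf hg =>
    obtain ⟨C, c, hc, h⟩ := hf
    obtain ⟨C', c', hc', h'⟩ := hg
    refine ⟨|C| + |C'|, min c c', lt_min hc hc', fun t => ?_⟩
    refine (norm_add_le _ _).trans ?_
    rw [add_mul]
    exact add_le_add
      ((h t).trans (exp_bound_mono (le_abs_self _) (abs_nonneg _) (min_le_left _ _) (abs_nonneg _)))
      ((h' t).trans (exp_bound_mono (le_abs_self _) (abs_nonneg _) (min_le_right _ _) (abs_nonneg _)))
  | smul a f _ hf =>
    obtain ⟨C, c, hc, h⟩ := hf
    refine ⟨‖a‖ * C, c, hc, fun t => ?_⟩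
    rw [norm_mul, mul_assoc]
    exact mul_le_mul_of_nonneg_left (h t) (norm_nonneg _)

lemma phiF_EClass (x y : ℝ) (hx : x ∈ Set.Ioo (0 : ℝ) 1) (hy : y ∈ Set.Ioo (0 : ℝ) 1) :
    EClass (fun t => phiF t x y) := by
  have : (fun t => phiF t x y) = qfun (eC y) (2 * Real.pi * x) 1 := by
    funext t
    unfold phiF qfun
    rw [div_eq_mul_inv, pow_one]
    congr 1
    · unfold eC; congr 1; push_cast
      linear_combination (2 * Real.pi * t * x : ℂ) * Complex.I_sq
    · congr 2; unfold eC; rw [← Complex.exp_add]; congr 1; push_cast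
      linear_combination (2 * Real.pi * t : ℂ) * Complex.I_sq
  rw [this]
  refine .gen _ ?_ ?_ _ _ (by have := hx.1; positivity) ?_
  · unfold eC
    rw [show (2 * Real.pi * Complex.I * y : ℂ) = (2 * Real.pi * y : ℝ) * Complex.I by push_cast; ring]
    exact Complex.norm_exp_ofReal_mul_I _
  · unfold eC
    rw [Ne, Complex.exp_eq_one_iff]
    rintro ⟨n, hn⟩
    have h2 : (y : ℂ) = n := by
      have : (2 * Real.pi * Complex.I : ℂ) ≠ 0 := Complex.two_pi_I_ne_zero
      apply mul_left_cancel₀ this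
      rw [hn]; ring
    have h3 : y = n := by exact_mod_cast h2
    have h4 := hy.1; have h5 := hy.2
    rw [h3] at h4 h5
    have : 0 < n := by exact_mod_cast h4
    have : n < 1 := by exact_mod_cast h5
    omega
  · have := hx.2
    have := Real.pi_pos
    push_cast; nlinarith

/-- multi-variable class of functions, closed under partial derivatives -/
inductive MClass {r : ℕ} (A : Matrix (Fin r) (Fin r) ℝ) : ((Fin r → ℝ) → ℂ) → Prop
  | prod (ψ : Fin r → ℝ → ℂ) (h : ∀ μ, EClass (ψ μ)) :
      MClass A (fun t => ∏ μ, ψ μ (Matrix.vecMul t A μ))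
  | zero : MClass A (fun _ => 0)
  | add (f g : (Fin r → ℝ) → ℂ) : MClass A f → MClass A g → MClass A (fun t => f t + g t)
  | smul (c : ℂ) (f : (Fin r → ℝ) → ℂ) : MClass A f → MClass A (fun t => c * f t)

lemma MClass.sum {r : ℕ} {A : Matrix (Fin r) (Fin r) ℝ} {ι : Type*} (s : Finset ι)
    (f : ι → (Fin r → ℝ) → ℂ) (h : ∀ i, MClass A (f i)) : MClass A (fun t => ∑ i ∈ s, f i t) := by
  classical
  induction s using Finset.induction_on with
  | empty => simpa using MClass.zero
  | insert a s ha ih =>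
    simp only [Finset.sum_insert ha]
    exact .add _ _ (h a) ih

lemma MClass.continuous {r : ℕ} {A : Matrix (Fin r) (Fin r) ℝ} {f : (Fin r → ℝ) → ℂ}
    (hf : MClass A f) : Continuous f := by
  induction hf with
  | prod ψ h =>
    refine continuous_finsetProd _ fun μ _ => (h μ).differentiable.1.continuous.comp ?_
    unfold Matrix.vecMul dotProduct
    fun_prop
  | zero => exact continuous_const
  | add f g _ _ hf hg => exact hf.add hg
  | smul c f _ hf => exact continuous_const.mul hf

lemma vecMul_update_hasDerivAt {r : ℕ} (A : Matrix (Fin r) (Fin r) ℝ) (t : Fin r → ℝ)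
    (ν μ : Fin r) (u : ℝ) :
    HasDerivAt (fun u => Matrix.vecMul (Function.update t ν u) A μ) (A ν μ) u := by
  have h : ∀ u, Matrix.vecMul (Function.update t ν u) A μ =
      u * A ν μ + ∑ i ∈ Finset.univ.erase ν, t i * A i μ := by
    intro u
    unfold Matrix.vecMul dotProduct
    rw [← Finset.add_sum_erase _ _ (Finset.mem_univ ν)]
    simp only [Function.update_self]
    congr 1
    refine Finset.sum_congr rfl fun i hi => ?_
    rw [Function.update_of_ne (Finset.ne_of_mem_erase hi)]
  simp_rw [h]
  refine HasDerivAt.add_const _ ?_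
  simpa using (hasDerivAt_id u).mul_const (A ν μ)

lemma MClass.pder_aux {r : ℕ} {A : Matrix (Fin r) (Fin r) ℝ} {f : (Fin r → ℝ) → ℂ}
    (hf : MClass A f) (ν : Fin r) :
    ∃ g, MClass A g ∧ ∀ t, HasDerivAt (fun u => f (Function.update t ν u)) (g t) (t ν) := by
  induction hf with
  | prod ψ h =>
    refine ⟨fun t => ∑ μ, (A ν μ : ℂ) *
      ∏ j, (Function.update ψ μ (deriv (ψ μ))) j (Matrix.vecMul t A j),
      MClass.sum _ _ fun μ => .smul _ _ (.prod _ fun j => ?_), fun t => ?_⟩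
    · rcases eq_or_ne j μ with rfl | hj
      · rw [Function.update_self]; exact (h j).differentiable.2
      · rw [Function.update_of_ne hj]; exact h j
    · have h1 : ∀ μ, HasDerivAt (fun u => ψ μ (Matrix.vecMul (Function.update t ν u) A μ))
          (A ν μ • deriv (ψ μ) (Matrix.vecMul t A μ)) (t ν) := by
        intro μ
        have h2 := (h μ).differentiable.1 (Matrix.vecMul (Function.update t ν (t ν)) A μ)
        have h3 := HasDerivAt.scomp (t ν) h2.hasDerivAt (vecMul_update_hasDerivAt A t ν μ (t ν))
        rw [Function.update_eq_self] at h3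
        exact h3
      have h4 := HasDerivAt.fun_finsetProd (u := Finset.univ) fun μ _ => h1 μ
      convert! h4 using 1
      refine Finset.sum_congr rfl fun μ _ => ?_
      rw [← Finset.prod_erase_mul _ _ (Finset.mem_univ μ), Function.update_self,
        Function.update_eq_self, Complex.real_smul, smul_eq_mul]
      rw [Finset.prod_congr rfl (g := fun j => ψ j (Matrix.vecMul t A j))]
      · ring
      · intro j hj
        rw [Function.update_of_ne (Finset.ne_of_mem_erase hj)]
  | zero => exact ⟨_, .zero, fun t => hasDerivAt_const _ _⟩
  | add f g _ _ hf hg =>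
    obtain ⟨f', hf', h1⟩ := hf
    obtain ⟨g', hg', h2⟩ := hg
    exact ⟨_, .add _ _ hf' hg', fun t => (h1 t).fun_add (h2 t)⟩
  | smul c f _ hf =>
    obtain ⟨f', hf', h1⟩ := hf
    exact ⟨_, .smul c _ hf', fun t => (h1 t).const_mul c⟩

lemma MClass.pder {r : ℕ} {A : Matrix (Fin r) (Fin r) ℝ} {f : (Fin r → ℝ) → ℂ}
    (hf : MClass A f) (ν : Fin r) : MClass A (pder ν f) := by
  obtain ⟨g, hg, h⟩ := hf.pder_aux ν
  have : _root_.pder ν f = g := funext fun t => (h t).deriv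
  rwa [this]

lemma MClass.hasDerivAt {r : ℕ} {A : Matrix (Fin r) (Fin r) ℝ} {f : (Fin r → ℝ) → ℂ}
    (hf : MClass A f) (ν : Fin r) (t : Fin r → ℝ) (u : ℝ) :
    HasDerivAt (fun u => f (Function.update t ν u)) (_root_.pder ν f (Function.update t ν u)) u := by
  obtain ⟨g, hg, h⟩ := hf.pder_aux ν
  have : _root_.pder ν f = g := funext fun t => (h t).deriv
  rw [this]
  simpa using h (Function.update t ν u)

lemma sum_abs_vecMul_ge {r : ℕ} (A : Matrix (Fin r) (Fin r) ℝ) (hA : A.det ≠ 0) :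
    ∃ κ : ℝ, 0 < κ ∧ ∀ t : Fin r → ℝ, κ * ∑ ν, |t ν| ≤ ∑ μ, |Matrix.vecMul t A μ| := by
  set M : ℝ := 1 + ∑ μ, ∑ ν, |A⁻¹ μ ν| with hM
  have hMpos : 0 < M := by positivity
  refine ⟨M⁻¹, inv_pos.mpr hMpos, fun t => ?_⟩
  rw [inv_mul_le_iff₀ hMpos]
  have ht : t = Matrix.vecMul (Matrix.vecMul t A) A⁻¹ := by
    rw [Matrix.vecMul_vecMul, Matrix.mul_nonsing_inv _ (isUnit_iff_ne_zero.mpr hA), Matrix.vecMul_one]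
  generalize Matrix.vecMul t A = l at ht
  subst ht
  calc ∑ ν, |Matrix.vecMul l A⁻¹ ν| ≤ ∑ ν, ∑ μ, |l μ| * |A⁻¹ μ ν| := by
        refine Finset.sum_le_sum fun ν _ => ?_
        unfold Matrix.vecMul dotProduct
        refine (Finset.abs_sum_le_sum_abs _ _).trans_eq ?_
        exact Finset.sum_congr rfl fun i _ => abs_mul _ _
    _ = ∑ μ, |l μ| * ∑ ν, |A⁻¹ μ ν| := by
        rw [Finset.sum_comm]
        exact Finset.sum_congr rfl fun μ _ => (Finset.mul_sum _ _ _).symm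
    _ ≤ ∑ μ, |l μ| * M := by
        refine Finset.sum_le_sum fun μ _ => mul_le_mul_of_nonneg_left ?_ (abs_nonneg _)
        have := Finset.single_le_sum (f := fun μ => ∑ ν, |A⁻¹ μ ν|)
          (fun i _ => Finset.sum_nonneg fun _ _ => abs_nonneg _) (Finset.mem_univ μ)
        linarith
    _ = M * ∑ μ, |l μ| := by rw [← Finset.sum_mul, mul_comm]

lemma MClass.bound {r : ℕ} {A : Matrix (Fin r) (Fin r) ℝ} (hA : A.det ≠ 0) {f : (Fin r → ℝ) → ℂ}
    (hf : MClass A f) :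
    ∃ C c : ℝ, 0 < c ∧ ∀ t, ‖f t‖ ≤ C * Real.exp (-(c * ∑ ν, |t ν|)) := by
  have hs : ∀ t : Fin r → ℝ, 0 ≤ ∑ ν, |t ν| := fun t => Finset.sum_nonneg fun _ _ => abs_nonneg _
  induction hf with
  | prod ψ h =>
    obtain ⟨κ, hκ, hA'⟩ := sum_abs_vecMul_ge A hA
    choose C c hc hb using fun μ => (h μ).bound
    obtain ⟨c0, hc0, hc0'⟩ : ∃ c0 : ℝ, 0 < c0 ∧ ∀ μ, c0 ≤ c μ := by
      rcases isEmpty_or_nonempty (Fin r) with hr | hr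
      · exact ⟨1, one_pos, fun μ => hr.elim μ⟩
      · obtain ⟨μ, hμ⟩ := Finite.exists_min c
        exact ⟨c μ, hc μ, hμ⟩
    refine ⟨∏ μ, |C μ|, c0 * κ, by positivity, fun t => ?_⟩
    rw [norm_prod]
    calc ∏ μ, ‖ψ μ (Matrix.vecMul t A μ)‖
        ≤ ∏ μ, |C μ| * Real.exp (-(c0 * |Matrix.vecMul t A μ|)) :=
          Finset.prod_le_prod (fun _ _ => norm_nonneg _) fun μ _ => (hb μ _).trans
            (exp_bound_mono (le_abs_self _) (abs_nonneg _) (hc0' μ) (abs_nonneg _))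
      _ = (∏ μ, |C μ|) * Real.exp (-(c0 * ∑ μ, |Matrix.vecMul t A μ|)) := by
          rw [Finset.prod_mul_distrib, ← Real.exp_sum, Finset.sum_neg_distrib, Finset.mul_sum]
      _ ≤ _ := by
          refine mul_le_mul_of_nonneg_left ?_ (by positivity)
          apply Real.exp_le_exp.mpr
          have := hA' t
          rw [mul_assoc]
          nlinarith
  | zero => exact ⟨0, 1, one_pos, by simp⟩
  | add f g _ _ hf hg =>
    obtain ⟨C, c, hc, h⟩ := hf
    obtain ⟨C', c', hc', h'⟩ := hg
    refine ⟨|C| + |C'|, min c c', lt_min hc hc', fun t => ?_⟩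
    refine (norm_add_le _ _).trans ?_
    rw [add_mul]
    exact add_le_add
      ((h t).trans (exp_bound_mono (le_abs_self _) (abs_nonneg _) (min_le_left _ _) (hs t)))
      ((h' t).trans (exp_bound_mono (le_abs_self _) (abs_nonneg _) (min_le_right _ _) (hs t)))
  | smul a f _ hf =>
    obtain ⟨C, c, hc, h⟩ := hf
    refine ⟨‖a‖ * C, c, hc, fun t => ?_⟩
    rw [norm_mul, mul_assoc]
    exact mul_le_mul_of_nonneg_left (h t) (norm_nonneg _)

/-- Riemann-Liouville type measure -/
def gm (s : ℝ) : Measure ℝ :=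
  if s = 0 then Measure.dirac 0 else
    (volume.restrict (Ioi 0)).withDensity (fun t => ENNReal.ofReal (t ^ (s - 1) / Real.Gamma s))

lemma gm_zero : gm 0 = Measure.dirac 0 := by simp [gm]

lemma gm_of_pos {s : ℝ} (hs : 0 < s) : gm s =
    (volume.restrict (Ioi 0)).withDensity (fun t => ENNReal.ofReal (t ^ (s - 1) / Real.Gamma s)) := by
  simp [gm, hs.ne']

instance gm_sigmaFinite (s : ℝ) : SigmaFinite (gm s) := by
  unfold gm
  split_ifs
  · infer_instance
  · exact SigmaFinite.withDensity_of_ne_top (Eventually.of_forall fun t => ENNReal.ofReal_ne_top)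

lemma gm_integrable_iff {E : Type*} [NormedAddCommGroup E] [NormedSpace ℝ E] {s : ℝ} (hs : 0 < s)
    (h : ℝ → E) :
    Integrable h (gm s) ↔ IntegrableOn (fun t => (t ^ (s - 1) / Real.Gamma s) • h t) (Ioi 0) := by
  rw [gm_of_pos hs, integrable_withDensity_iff_integrable_smul' (by fun_prop) (by simp)]
  refine integrableOn_congr_fun (fun t ht => ?_) measurableSet_Ioi
  have ht : 0 < t := ht
  rw [ENNReal.toReal_ofReal (div_nonneg (Real.rpow_nonneg ht.le _) (Real.Gamma_pos_of_pos hs).le)]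

lemma gm_integral {E : Type*} [NormedAddCommGroup E] [NormedSpace ℝ E] {s : ℝ} (hs : 0 < s)
    (h : ℝ → E) :
    ∫ t, h t ∂(gm s) = ∫ t in Ioi 0, (t ^ (s - 1) / Real.Gamma s) • h t := by
  rw [gm_of_pos hs, integral_withDensity_eq_integral_toReal_smul (by fun_prop) (by simp)]
  refine setIntegral_congr_fun measurableSet_Ioi (fun t ht => ?_)
  have ht : 0 < t := ht
  rw [ENNReal.toReal_ofReal (div_nonneg (Real.rpow_nonneg ht.le _) (Real.Gamma_pos_of_pos hs).le)]

lemma gm_exp_integrable {s : ℝ} (hs : 0 ≤ s) {c : ℝ} (hc : 0 < c) :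
    Integrable (fun t : ℝ => Real.exp (-(c * |t|))) (gm s) := by
  rcases hs.eq_or_lt with rfl | hs
  · rw [gm_zero]; exact integrable_dirac (by simp)
  · rw [gm_integrable_iff hs]
    have := (integrableOn_rpow_mul_exp_neg_mul_rpow (s := s - 1) (p := 1) (by linarith) one_pos hc).const_mul
      (Real.Gamma s)⁻¹
    refine IntegrableOn.congr_fun this (fun t ht => ?_) measurableSet_Ioi
    have ht : 0 < t := ht
    simp [abs_of_pos ht]
    ring

lemma gm_bdd_integrable {s : ℝ} (hs : 0 ≤ s) {h : ℝ → ℂ} (hcont : Continuous h) {C c : ℝ}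
    (hc : 0 < c) (hb : ∀ t, ‖h t‖ ≤ C * Real.exp (-(c * |t|))) : Integrable h (gm s) :=
  ((gm_exp_integrable hs hc).const_mul C).mono' hcont.aestronglyMeasurable (Eventually.of_forall hb)

lemma gm_by_parts {s : ℝ} (hs : 0 ≤ s) {h h' : ℝ → ℂ} (hd : ∀ t, HasDerivAt h (h' t) t)
    (hcont : Continuous h') {C c : ℝ} (hc : 0 < c)
    (hb : ∀ t, ‖h t‖ ≤ C * Real.exp (-(c * |t|))) (hb' : ∀ t, ‖h' t‖ ≤ C * Real.exp (-(c * |t|))) :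
    ∫ t, h t ∂(gm s) = - ∫ t, h' t ∂(gm (s + 1)) := by
  have hconth : Continuous h := continuous_iff_continuousAt.mpr fun t => (hd t).continuousAt
  have hi' := gm_bdd_integrable (s := s + 1) (by linarith) hcont hc hb'
  rw [gm_integrable_iff (by linarith)] at hi'
  have hi := gm_bdd_integrable hs hconth hc hb
  rw [gm_integral (s := s + 1) (by linarith)]
  rcases hs.eq_or_lt with rfl | hs
  · rw [gm_zero, integral_dirac]
    simp at hi' ⊢
    have ht : Tendsto h atTop (𝓝 0) := by
      have h1 : Tendsto (fun t : ℝ => C * Real.exp (-(c * t))) atTop (𝓝 (C * 0)) :=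
        (Real.tendsto_exp_neg_atTop_nhds_zero.comp (tendsto_id.const_mul_atTop hc)).const_mul C
      rw [mul_zero] at h1
      refine squeeze_zero_norm' ?_ h1
      filter_upwards [eventually_ge_atTop 0] with t ht
      simpa [abs_of_nonneg ht] using hb t
    rw [integral_Ioi_of_hasDerivAt_of_tendsto' (fun t _ => hd t) hi' ht]
    simp
  · rw [gm_integral hs]
    rw [gm_integrable_iff hs] at hi
    have hG : 0 < Real.Gamma s := Real.Gamma_pos_of_pos hs
    simp only [add_sub_cancel_right, Complex.real_smul] at *
    have hu : ∀ t ∈ Ioi (0 : ℝ), HasDerivAt (fun t : ℝ => ((t ^ s / Real.Gamma (s + 1) : ℝ) : ℂ))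
        ((t ^ (s - 1) / Real.Gamma s : ℝ) : ℂ) t := by
      intro t ht
      have ht : 0 < t := ht
      have := ((Real.hasDerivAt_rpow_const (x := t) (p := s) (Or.inl ht.ne')).div_const
        (Real.Gamma (s + 1))).ofReal_comp
      convert! this using 2
      rw [Real.Gamma_add_one hs.ne']
      field_simp
    have hbd : ∀ t : ℝ, 0 ≤ t → ‖((t ^ s / Real.Gamma (s + 1) : ℝ) : ℂ) * h t‖ ≤
        (C / Real.Gamma (s + 1)) * (t ^ s * Real.exp (-c * t)) := by
      intro t ht
      rw [norm_mul, Complex.norm_real, Real.norm_of_nonneg (by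
        have := Real.rpow_nonneg ht s
        have := Real.Gamma_pos_of_pos (show 0 < s + 1 by linarith)
        positivity)]
      have h1 := hb t
      rw [abs_of_nonneg ht] at h1
      calc _ ≤ t ^ s / Real.Gamma (s + 1) * (C * Real.exp (-(c * t))) :=
            mul_le_mul_of_nonneg_left h1 (by
              have := Real.rpow_nonneg ht s
              have := Real.Gamma_pos_of_pos (show 0 < s + 1 by linarith)
              positivity)
        _ = _ := by rw [neg_mul]; ring
    have hinf : Tendsto ((fun t : ℝ => ((t ^ s / Real.Gamma (s + 1) : ℝ) : ℂ)) * h) atTop (𝓝 0) := by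
      have h1 := (tendsto_rpow_mul_exp_neg_mul_atTop_nhds_zero s c hc).const_mul
        (C / Real.Gamma (s + 1))
      rw [mul_zero] at h1
      refine squeeze_zero_norm' ?_ h1
      filter_upwards [eventually_ge_atTop 0] with t ht using hbd t ht
    have hzero : Tendsto ((fun t : ℝ => ((t ^ s / Real.Gamma (s + 1) : ℝ) : ℂ)) * h) (𝓝[>] 0) (𝓝 0) := by
      have h1 : ContinuousAt ((fun t : ℝ => ((t ^ s / Real.Gamma (s + 1) : ℝ) : ℂ)) * h) 0 := by
        refine ContinuousAt.mul ?_ hconth.continuousAt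
        refine Complex.continuous_ofReal.continuousAt.comp ?_
        exact ((Real.continuous_rpow_const hs.le).continuousAt).div_const _
      have h2 := h1.tendsto
      rw [Pi.mul_apply, Real.zero_rpow hs.ne', zero_div, Complex.ofReal_zero, zero_mul] at h2
      exact h2.mono_left nhdsWithin_le_nhds
    have key := integral_Ioi_mul_deriv_eq_deriv_mul hu (fun t _ => hd t) hi' hi hzero hinf
    rw [key]
    simp

/-- `Measure.pi` commutes with densities: Tonelli for products of functions. -/
lemma lintegral_fin_prod {n : ℕ} (μ : Fin n → Measure ℝ) [∀ i, SigmaFinite (μ i)]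
    (f : Fin n → ℝ → ENNReal) (hf : ∀ i, Measurable (f i)) :
    ∫⁻ x, ∏ i, f i (x i) ∂(Measure.pi μ) = ∏ i, ∫⁻ x, f i x ∂(μ i) := by
  induction n with
  | zero => simp
  | succ n ih =>
    rw [← ((measurePreserving_piFinSuccAbove μ 0).symm).lintegral_comp_emb
      (MeasurableEquiv.measurableEmbedding _)]
    simp_rw [MeasurableEquiv.piFinSuccAbove_symm_apply, Fin.insertNthEquiv,
      Fin.prod_univ_succ, Fin.insertNth_zero, Equiv.coe_fn_mk, Fin.cons_succ, 
      Fin.zero_succAbove, Fin.cons_zero]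
    rw [← ih (fun i => μ i.succ) (fun i => f i.succ) (fun i => hf _)]
    rw [← lintegral_prod_mul (hf 0).aemeasurable]
    · rfl
    · exact (Finset.measurable_prod _ fun i _ => (hf _).comp (measurable_pi_apply i)).aemeasurable

lemma pi_withDensity {n : ℕ} (μ : Fin n → Measure ℝ) [∀ i, SigmaFinite (μ i)]
    (f : Fin n → ℝ → ENNReal) (hf : ∀ i, Measurable (f i))
    [∀ i, SigmaFinite ((μ i).withDensity (f i))] :
    Measure.pi (fun i => (μ i).withDensity (f i)) =
      (Measure.pi μ).withDensity (fun x => ∏ i, f i (x i)) := by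
  refine Measure.pi_eq fun s hs => ?_
  rw [withDensity_apply _ (MeasurableSet.univ_pi hs), Measure.restrict_pi_pi, lintegral_fin_prod _ _ hf]
  exact Finset.prod_congr rfl fun i _ => (withDensity_apply _ (hs i)).symm

lemma gm_pi {n : ℕ} (s : Fin n → ℝ) (hs : ∀ i, 0 < s i) :
    Measure.pi (fun i => gm (s i)) =
      ((volume : Measure (Fin n → ℝ)).restrict (Set.univ.pi fun _ => Ioi 0)).withDensity
        (fun x => ENNReal.ofReal (∏ i, (|x i| ^ (s i - 1) / Real.Gamma (s i)))) := by
  have h1 : ∀ i, gm (s i) = (volume.restrict (Ioi 0)).withDensity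
      (fun t => ENNReal.ofReal (|t| ^ (s i - 1) / Real.Gamma (s i))) := by
    intro i
    rw [gm_of_pos (hs i)]
    refine withDensity_congr_ae ?_
    filter_upwards [ae_restrict_mem measurableSet_Ioi] with t ht
    rw [abs_of_pos ht]
  have hsf : ∀ i, SigmaFinite ((volume.restrict (Ioi (0 : ℝ))).withDensity
      (fun t => ENNReal.ofReal (|t| ^ (s i - 1) / Real.Gamma (s i)))) := by
    intro i; rw [← h1]; infer_instance
  simp_rw [h1]
  rw [pi_withDensity (fun _ => volume.restrict (Ioi (0:ℝ))) _ (fun i => by fun_prop), volume_pi, Measure.restrict_pi_pi]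
  congr 1
  funext x
  rw [ENNReal.ofReal_prod_of_nonneg]
  intro i _
  exact div_nonneg (Real.rpow_nonneg (abs_nonneg _) _) (Real.Gamma_pos_of_pos (hs i)).le

lemma gm_pi_integral {n : ℕ} (s : Fin n → ℝ) (hs : ∀ i, 0 < s i) (g : (Fin n → ℝ) → ℂ) :
    ∫ x, g x ∂(Measure.pi (fun i => gm (s i))) =
      ∫ x in Set.univ.pi fun _ => Ioi 0,
        g x * ((∏ i, (x i ^ (s i - 1) / Real.Gamma (s i)) : ℝ) : ℂ) := by
  rw [gm_pi s hs, integral_withDensity_eq_integral_toReal_smul (by fun_prop) (by simp)]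
  refine setIntegral_congr_fun (MeasurableSet.univ_pi fun _ => measurableSet_Ioi) (fun x hx => ?_)
  have hx : ∀ i, 0 < x i := fun i => hx i (mem_univ i)
  rw [ENNReal.toReal_ofReal (Finset.prod_nonneg fun i _ =>
    div_nonneg (Real.rpow_nonneg (abs_nonneg _) _) (Real.Gamma_pos_of_pos (hs i)).le), Complex.real_smul,
    mul_comm]
  simp only [abs_of_pos (hx _)]

lemma gm_pi_integrable {n : ℕ} (s : Fin n → ℝ) (hs : ∀ i, 0 ≤ s i) {g : (Fin n → ℝ) → ℂ}
    (hg : Continuous g) {C c : ℝ} (hc : 0 < c) (hb : ∀ t, ‖g t‖ ≤ C * Real.exp (-(c * ∑ ν, |t ν|))) :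
    Integrable g (Measure.pi (fun i => gm (s i))) := by
  have h1 := (Integrable.fintype_prod (μ := fun i => gm (s i)) (f := fun _ t => Real.exp (-(c * |t|)))
    (fun i => gm_exp_integrable (hs i) hc)).const_mul C
  refine h1.mono' hg.aestronglyMeasurable (Eventually.of_forall fun t => ?_)
  refine (hb t).trans_eq ?_
  rw [← Real.exp_sum, Finset.sum_neg_distrib, Finset.mul_sum]

lemma pi_slice {n : ℕ} (m : Fin (n + 1) → Measure ℝ) [∀ i, SigmaFinite (m i)] (ν : Fin (n + 1))
    (f : (Fin (n + 1) → ℝ) → ℂ) (hf : Integrable f (Measure.pi m)) :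
    ∫ x, f x ∂(Measure.pi m) =
      ∫ t, ∫ u, f (ν.insertNth u t) ∂(m ν) ∂(Measure.pi fun j => m (ν.succAbove j)) := by
  have hmp := (measurePreserving_piFinSuccAbove m ν).symm
  rw [← hmp.integral_comp', integral_prod_symm]
  · rfl
  · exact (hmp.integrable_comp_emb (MeasurableEquiv.measurableEmbedding _)).mpr hf

/-- iterated Riemann-Liouville integral -/
def Jint {r : ℕ} (f : (Fin r → ℝ) → ℂ) (s : Fin r → ℝ) : ℂ :=
  ∫ x, f x ∂(Measure.pi fun i => gm (s i))

lemma insertNth_eq_update {n : ℕ} (ν : Fin (n + 1)) (u : ℝ) (t : Fin n → ℝ) :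
    (ν.insertNth u t : Fin (n + 1) → ℝ) = Function.update (ν.insertNth 0 t) ν u := by
  simp

lemma Jint_step {r : ℕ} {A : Matrix (Fin r) (Fin r) ℝ} (hA : A.det ≠ 0) {f : (Fin r → ℝ) → ℂ}
    (hf : MClass A f) (s : Fin r → ℝ) (hs : ∀ i, 0 ≤ s i) (ν : Fin r) :
    Jint f s = - Jint (pder ν f) (s + Pi.single ν 1) := by
  obtain ⟨C1, c1, hc1, h1⟩ := hf.bound hA
  obtain ⟨C2, c2, hc2, h2⟩ := (hf.pder ν).bound hA
  have hs' : ∀ i, 0 ≤ (s + (Pi.single ν (1 : ℝ) : Fin _ → ℝ)) i := fun i => by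
    have : (0 : ℝ) ≤ (Pi.single ν (1 : ℝ) : Fin r → ℝ) i := by
      have : (0 : Fin r → ℝ) ≤ Pi.single ν (1 : ℝ) := Pi.single_nonneg.mpr zero_le_one
      exact this i
    exact add_nonneg (hs i) this
  have hi1 := gm_pi_integrable s hs hf.continuous hc1 h1
  have hi2 := gm_pi_integrable _ hs' (hf.pder ν).continuous hc2 h2
  rcases r with _ | n
  · exact ν.elim0
  unfold Jint
  rw [pi_slice _ ν _ hi1, pi_slice _ ν _ hi2, ← integral_neg]
  have e1 : (fun j => gm ((s + (Pi.single ν (1 : ℝ) : Fin _ → ℝ)) (ν.succAbove j))) = fun j => gm (s (ν.succAbove j)) := by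
    funext j
    simp [Pi.single_eq_of_ne (Fin.succAbove_ne ν j)]
  have e2 : (s + (Pi.single ν (1 : ℝ) : Fin _ → ℝ)) ν = s ν + 1 := by simp
  rw [e1, e2]
  congr 1
  funext t
  have hle : ∀ u, |u| ≤ ∑ i, |(ν.insertNth u t : Fin (n + 1) → ℝ) i| := by
    intro u
    have := Finset.single_le_sum (f := fun i => |(ν.insertNth u t : Fin (n + 1) → ℝ) i|)
      (fun i _ => abs_nonneg _) (Finset.mem_univ ν)
    simpa using this
  have hbd : ∀ (C c C' c' : ℝ), 0 < c' → C ≤ C' → 0 ≤ C' → c' ≤ c → ∀ u : ℝ,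
      C * Real.exp (-(c * ∑ i, |(ν.insertNth u t : Fin (n + 1) → ℝ) i|)) ≤
        C' * Real.exp (-(c' * |u|)) := by
    intro C c C' c' hc' hC hC' hcc u
    apply mul_le_mul hC _ (Real.exp_pos _).le hC'
    apply Real.exp_le_exp.mpr
    have := hle u
    have := abs_nonneg u
    nlinarith
  refine gm_by_parts (hs ν) (C := max |C1| |C2|) (c := min c1 c2) ?_ ?_ (lt_min hc1 hc2) ?_ ?_
  · intro u
    have := hf.hasDerivAt ν (ν.insertNth 0 t) u
    simpa only [← insertNth_eq_update] using this
  · have : Continuous fun u : ℝ => Function.update (ν.insertNth 0 t : Fin (n + 1) → ℝ) ν u :=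
      continuous_const.update ν continuous_id
    simpa only [← insertNth_eq_update, Function.comp_def] using (hf.pder ν).continuous.comp this
  · intro u
    exact (h1 _).trans (hbd _ _ _ _ (lt_min hc1 hc2) ((le_abs_self _).trans (le_max_left _ _))
      (le_max_of_le_left (abs_nonneg _)) (min_le_left _ _) u)
  · intro u
    exact (h2 _).trans (hbd _ _ _ _ (lt_min hc1 hc2) ((le_abs_self _).trans (le_max_right _ _))
      (le_max_of_le_left (abs_nonneg _)) (min_le_right _ _) u)

lemma MClass.pder_iter {r : ℕ} {A : Matrix (Fin r) (Fin r) ℝ} {f : (Fin r → ℝ) → ℂ}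
    (hf : MClass A f) (ν : Fin r) (n : ℕ) : MClass A ((_root_.pder ν)^[n] f) := by
  induction n with
  | zero => exact hf
  | succ n ih => rw [Function.iterate_succ_apply']; exact ih.pder ν

lemma Jint_iter {r : ℕ} {A : Matrix (Fin r) (Fin r) ℝ} (hA : A.det ≠ 0) {f : (Fin r → ℝ) → ℂ}
    (hf : MClass A f) (s : Fin r → ℝ) (hs : ∀ i, 0 ≤ s i) (ν : Fin r) (n : ℕ) :
    Jint f s = (-1) ^ n * Jint ((pder ν)^[n] f) (s + Pi.single ν (n : ℝ)) := by
  induction n with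
  | zero => simp
  | succ n ih =>
    rw [ih, Jint_step hA (hf.pder_iter ν n) _ _ ν, Function.iterate_succ_apply', add_assoc,
      ← Pi.single_add]
    · push_cast; ring
    · intro i
      have : (0 : Fin r → ℝ) ≤ Pi.single ν (n : ℝ) := Pi.single_nonneg.mpr n.cast_nonneg
      exact add_nonneg (hs i) (this i)

lemma Jint_list {r : ℕ} {A : Matrix (Fin r) (Fin r) ℝ} (hA : A.det ≠ 0) {f : (Fin r → ℝ) → ℂ}
    (hf : MClass A f) (s : Fin r → ℝ) (hs : ∀ i, 0 ≤ s i) (k : Fin r → ℕ) (l : List (Fin r)) :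
    MClass A (l.foldr (fun ν h => (pder ν)^[k ν] h) f) ∧
    (∀ i, 0 ≤ (l.map fun ν => (Pi.single ν (k ν : ℝ) : Fin r → ℝ)).sum i) ∧
    Jint f s = (-1) ^ (l.map k).sum * Jint (l.foldr (fun ν h => (pder ν)^[k ν] h) f)
      (s + (l.map fun ν => Pi.single ν (k ν : ℝ)).sum) := by
  induction l with
  | nil => simp [hf]
  | cons ν l ih =>
    obtain ⟨h1, h2, h3⟩ := ih
    refine ⟨h1.pder_iter ν _, fun i => ?_, ?_⟩
    · have : (0 : Fin r → ℝ) ≤ Pi.single ν (k ν : ℝ) := Pi.single_nonneg.mpr (k ν).cast_nonneg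
      simp only [List.map_cons, List.sum_cons, Pi.add_apply]
      exact add_nonneg (this i) (h2 i)
    · rw [h3, Jint_iter hA h1 (s + _) (fun i => add_nonneg (hs i) (h2 i)) ν (k ν)]
      simp only [List.map_cons, List.sum_cons, List.foldr_cons]
      rw [add_assoc, add_comm (Pi.single ν (k ν : ℝ) : Fin r → ℝ), pow_add]
      ring

lemma MClass.pderMulti {r : ℕ} {A : Matrix (Fin r) (Fin r) ℝ} {f : (Fin r → ℝ) → ℂ}
    (hA : A.det ≠ 0) (hf : MClass A f) (k : Fin r → ℕ) : MClass A (pderMulti k f) :=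
  (Jint_list hA hf (fun _ => 0) (fun _ => le_rfl) k _).1

lemma Jint_multi {r : ℕ} {A : Matrix (Fin r) (Fin r) ℝ} (hA : A.det ≠ 0) {f : (Fin r → ℝ) → ℂ}
    (hf : MClass A f) (s : Fin r → ℝ) (hs : ∀ i, 0 ≤ s i) (k : Fin r → ℕ) :
    Jint f s = (-1) ^ (∑ ν, k ν) * Jint (pderMulti k f) (fun ν => s ν + k ν) := by
  have h := (Jint_list hA hf s hs k (List.finRange r)).2.2
  rw [← Fin.sum_univ_def, ← Fin.sum_univ_def, Finset.univ_sum_single (fun ν => (k ν : ℝ))] at h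
  exact h

lemma Jint_zero {r : ℕ} (f : (Fin r → ℝ) → ℂ) : Jint f (fun _ => 0) = f 0 := by
  unfold Jint
  have : Measure.pi (fun _ : Fin r => gm 0) = Measure.dirac 0 := by
    refine Measure.pi_eq fun s hs => ?_
    simp only [gm_zero]
    rw [Measure.dirac_apply' _ (MeasurableSet.univ_pi hs)]
    simp_rw [Measure.dirac_apply' _ (hs _)]
    by_cases h : ∀ i, (0 : ℝ) ∈ s i
    · rw [indicator_of_mem (by simpa [Set.mem_pi] using h)]
      rw [Finset.prod_eq_one]; · rfl
      intro i _; rw [indicator_of_mem (h i)]; rfl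
    · rw [indicator_of_notMem (by simpa [Set.mem_pi] using h)]
      push Not at h
      obtain ⟨i, hi⟩ := h
      rw [Finset.prod_eq_zero (Finset.mem_univ i)]
      rw [indicator_of_notMem hi]
  rw [this, integral_dirac]

/-- positive orthant -/
def orth (r : ℕ) : Set (Fin r → ℝ) := Set.univ.pi fun _ => Ioi 0

lemma orth_meas (r : ℕ) : MeasurableSet (orth r) := MeasurableSet.univ_pi fun _ => measurableSet_Ioi

/-- sum of logs -/
def Llog {r : ℕ} (x : Fin r → ℝ) : ℝ := ∑ i, Real.log (x i)

lemma Llog_meas (r : ℕ) : Measurable (Llog (r := r)) := by unfold Llog; fun_prop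

lemma exp_Llog {r : ℕ} {x : Fin r → ℝ} (hx : x ∈ orth r) (p : ℝ) :
    Real.exp (p * Llog x) = ∏ i, x i ^ p := by
  unfold Llog
  rw [Finset.mul_sum, Real.exp_sum]
  refine Finset.prod_congr rfl fun i _ => ?_
  rw [Real.rpow_def_of_pos (hx i (mem_univ i)), mul_comm]

lemma orth_integrable {r : ℕ} {g : (Fin r → ℝ) → ℂ}
    (hg : Continuous g) {C c : ℝ} (hc : 0 < c) (hb : ∀ t, ‖g t‖ ≤ C * Real.exp (-(c * ∑ ν, |t ν|)))
    (p : ℝ) (hp : 0 < p) :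
    IntegrableOn (fun x => ‖g x‖ * Real.exp ((p - 1) * Llog x)) (orth r) := by
  have h1 := (gm_pi_integrable (fun _ : Fin r => p) (fun _ => hp.le) hg hc hb).norm
  rw [gm_pi _ (fun _ => hp), integrable_withDensity_iff_integrable_smul' (by fun_prop) (by simp)] at h1
  have h2 := h1.const_mul (∏ _i : Fin r, Real.Gamma p)
  refine IntegrableOn.congr_fun h2 (fun x hx => ?_) (orth_meas r)
  have hx' : ∀ i, 0 < x i := fun i => hx i (mem_univ i)
  have hG := Real.Gamma_pos_of_pos hp
  simp only [abs_of_pos (hx' _)]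
  rw [ENNReal.toReal_ofReal (Finset.prod_nonneg fun i _ =>
    div_nonneg (Real.rpow_nonneg (hx' i).le _) hG.le), exp_Llog hx, Finset.prod_div_distrib]
  have : (∏ _i : Fin r, Real.Gamma p) ≠ 0 := Finset.prod_ne_zero_iff.mpr fun _ _ => hG.ne'
  rw [smul_eq_mul]
  field_simp

lemma log_exp_bound {a b L ε : ℝ} (hε : 0 < ε) (hab : |b - a| ≤ ε) :
    |L| * Real.exp (b * L) ≤ ε⁻¹ * (Real.exp ((a + 2 * ε) * L) + Real.exp ((a - 2 * ε) * L)) := by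
  have h1 : |L| ≤ ε⁻¹ * Real.exp (ε * |L|) := by
    have := Real.add_one_le_exp (ε * |L|)
    rw [inv_mul_eq_div, le_div_iff₀ hε]
    linarith
  have h2 : Real.exp (b * L) ≤ Real.exp (a * L + ε * |L|) := by
    apply Real.exp_le_exp.mpr
    have h3 : (b - a) * L ≤ |b - a| * |L| := by rw [← abs_mul]; exact le_abs_self _
    have h4 := mul_le_mul_of_nonneg_right hab (abs_nonneg L)
    linarith
  calc |L| * Real.exp (b * L) ≤ (ε⁻¹ * Real.exp (ε * |L|)) * Real.exp (a * L + ε * |L|) :=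
        mul_le_mul h1 h2 (Real.exp_pos _).le (by positivity)
    _ = ε⁻¹ * Real.exp (a * L + 2 * ε * |L|) := by
        rw [mul_assoc, ← Real.exp_add]; congr 2; ring
    _ ≤ _ := by
        refine mul_le_mul_of_nonneg_left ?_ (by positivity)
        rcases abs_cases L with ⟨h, _⟩ | ⟨h, _⟩
        · rw [h, show a * L + 2 * ε * L = (a + 2 * ε) * L by ring]
          linarith [Real.exp_pos ((a - 2 * ε) * L)]
        · rw [h, show a * L + 2 * ε * -L = (a - 2 * ε) * L by ring]
          linarith [Real.exp_pos ((a + 2 * ε) * L)]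

/-- multi-dimensional diagonal Mellin transform -/
def Kint {r : ℕ} (g : (Fin r → ℝ) → ℂ) (z : ℂ) : ℂ :=
  ∫ x in orth r, g x * Complex.exp ((z - 1) * (Llog x : ℂ))

lemma norm_cexp_Llog {r : ℕ} (z : ℂ) (x : Fin r → ℝ) :
    ‖Complex.exp ((z - 1) * (Llog x : ℂ))‖ = Real.exp ((z.re - 1) * Llog x) := by
  rw [Complex.norm_exp]; simp

lemma Kint_differentiableAt {r : ℕ} {g : (Fin r → ℝ) → ℂ}
    (hg : Continuous g) {C c : ℝ} (hc : 0 < c) (hb : ∀ t, ‖g t‖ ≤ C * Real.exp (-(c * ∑ ν, |t ν|)))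
    (z₀ : ℂ) (hz : 0 < z₀.re) : DifferentiableAt ℂ (Kint g) z₀ := by
  set ε := z₀.re / 4 with hε
  have hεp : 0 < ε := by positivity
  have hLm : Measurable fun x : Fin r → ℝ => (Llog x : ℂ) := Complex.measurable_ofReal.comp (Llog_meas r)
  have hF : ∀ z : ℂ, AEStronglyMeasurable
      (fun x : Fin r → ℝ => g x * Complex.exp ((z - 1) * (Llog x : ℂ))) (volume.restrict (orth r)) := by
    intro z
    exact hg.aestronglyMeasurable.mul
      (Complex.measurable_exp.comp (hLm.const_mul (z - 1))).aestronglyMeasurable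
  refine (hasDerivAt_integral_of_dominated_loc_of_deriv_le (s := Metric.ball z₀ ε)
    (F := fun z x => g x * Complex.exp ((z - 1) * (Llog x : ℂ)))
    (F' := fun z x => g x * (Complex.exp ((z - 1) * (Llog x : ℂ)) * (Llog x : ℂ)))
    (bound := fun x => ε⁻¹ * (‖g x‖ * Real.exp ((z₀.re + 2 * ε - 1) * Llog x) +
      ‖g x‖ * Real.exp ((z₀.re - 2 * ε - 1) * Llog x)))
    (Metric.ball_mem_nhds z₀ hεp) (Eventually.of_forall hF) ?_ ?_ ?_ ?_ ?_).2.differentiableAt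
  · refine (orth_integrable hg hc hb z₀.re hz).mono' (hF z₀) (Eventually.of_forall fun x => ?_)
    rw [norm_mul, norm_cexp_Llog]
  · exact hg.aestronglyMeasurable.mul
      ((Complex.measurable_exp.comp (hLm.const_mul (z₀ - 1))).mul hLm).aestronglyMeasurable
  · refine Eventually.of_forall fun x z hz' => ?_
    rw [norm_mul, norm_mul, norm_cexp_Llog, Complex.norm_real, Real.norm_eq_abs]
    have h1 : |(z.re - 1) - (z₀.re - 1)| ≤ ε := by
      have := Complex.abs_re_le_norm (z - z₀)
      rw [Metric.mem_ball, dist_eq_norm] at hz'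
      rw [Complex.sub_re] at this
      rw [sub_sub_sub_cancel_right]
      linarith
    have h2 := log_exp_bound (L := Llog x) hεp h1
    have h3 := mul_le_mul_of_nonneg_left h2 (norm_nonneg (g x))
    rw [mul_comm |Llog x|] at h3
    refine h3.trans_eq ?_
    rw [show z₀.re - 1 + 2 * ε = z₀.re + 2 * ε - 1 by ring,
      show z₀.re - 1 - 2 * ε = z₀.re - 2 * ε - 1 by ring]
    ring
  · exact ((orth_integrable hg hc hb _ (by linarith)).add
      (orth_integrable hg hc hb _ (by linarith))).const_mul _
  · refine Eventually.of_forall fun x z _ => ?_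
    have h1 : HasDerivAt (fun z : ℂ => (z - 1) * (Llog x : ℂ)) (Llog x : ℂ) z := by
      simpa using ((hasDerivAt_id z).sub_const 1).mul_const (Llog x : ℂ)
    exact h1.cexp.const_mul (g x)

lemma Jint_eq_Kint {r : ℕ} (g : (Fin r → ℝ) → ℂ) (σ : ℝ) (hσ : 0 < σ) :
    Jint g (fun _ => σ) = (Complex.Gamma σ)⁻¹ ^ r * Kint g σ := by
  unfold Jint Kint
  rw [gm_pi_integral _ (fun _ => hσ), ← integral_const_mul]
  refine setIntegral_congr_fun (orth_meas r) fun x hx => ?_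
  have := exp_Llog hx (σ - 1)
  rw [Finset.prod_div_distrib, ← this, Complex.Gamma_ofReal]
  simp [div_eq_mul_inv]
  ring

lemma ShintaniL_eq_Jint {r : ℕ} (A : Matrix (Fin r) (Fin r) ℝ) (x y : Fin r → ℝ) (s : Fin r → ℝ)
    (hs : ∀ i, 0 < s i) :
    ShintaniL (fun i => (s i : ℂ)) A x y =
      (∏ i, (2 * (Real.pi : ℂ)) ^ (s i : ℂ)) * Jint (fun t => FF (Matrix.vecMul t A) x y) s := by
  unfold ShintaniL Jint
  rw [gm_pi_integral _ hs, ← integral_const_mul, ← integral_const_mul]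
  refine setIntegral_congr_fun (orth_meas r) fun t ht => ?_
  have ht' : ∀ i, 0 < t i := fun i => ht i (mem_univ i)
  have h2 : (2 : ℂ) ^ r = ∏ _i : Fin r, (2 : ℂ) := by simp
  have h3 : ((∏ i, (t i ^ (s i - 1) / Real.Gamma (s i)) : ℝ) : ℂ) =
      ∏ i, ((t i : ℂ) ^ (s i : ℂ) * (t i : ℂ)⁻¹ * (Complex.Gamma (s i))⁻¹) := by
    rw [Complex.ofReal_prod]
    refine Finset.prod_congr rfl fun i _ => ?_
    rw [Complex.Gamma_ofReal, Real.rpow_sub_one (ht' i).ne', Complex.ofReal_div, Complex.ofReal_div,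
      Complex.ofReal_cpow (ht' i).le, div_eq_mul_inv, div_eq_mul_inv]
  simp only
  rw [h3, h2, mul_left_comm, mul_left_comm (∏ i, (2 * (Real.pi : ℂ)) ^ (s i : ℂ)), ← Finset.prod_inv_distrib,
    ← Finset.prod_mul_distrib, ← Finset.prod_mul_distrib, ← Finset.prod_mul_distrib]
  congr 1
  refine Finset.prod_congr rfl fun i _ => ?_
  unfold GammaC
  rw [Complex.cpow_neg, mul_inv, mul_inv, inv_inv]
  ring

lemma eq_one_of_real_eq {H R : ℂ → ℂ} (hH : Differentiable ℂ H)
    (hR : ∀ z : ℂ, 0 < z.re → DifferentiableAt ℂ R z) (a : ℝ) (ha : 0 < a)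
    (h : ∀ σ : ℝ, a < σ → H σ = R σ) : H 1 = R 1 := by
  have hU : IsOpen {z : ℂ | 0 < z.re} := isOpen_lt continuous_const Complex.continuous_re
  have h1 : AnalyticOnNhd ℂ H {z : ℂ | 0 < z.re} := hH.differentiableOn.analyticOnNhd hU
  have h2 : AnalyticOnNhd ℂ R {z : ℂ | 0 < z.re} :=
    DifferentiableOn.analyticOnNhd (fun z hz => (hR z hz).differentiableWithinAt) hU
  have hconv : Convex ℝ {z : ℂ | 0 < z.re} := convex_halfSpace_re_gt 0
  have hreal : ∃ᶠ σ : ℝ in 𝓝[≠] (a + 1), H σ = R σ := by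
    refine Eventually.frequently ?_
    refine eventually_nhdsWithin_of_eventually_nhds ?_
    filter_upwards [lt_mem_nhds (show a < a + 1 by linarith)] with σ hσ using h σ hσ
  have ht : Tendsto (fun σ : ℝ => (σ : ℂ)) (𝓝[≠] (a + 1)) (𝓝[≠] ((a + 1 : ℝ) : ℂ)) := by
    refine tendsto_nhdsWithin_of_tendsto_nhds_of_eventually_within _
      (Complex.continuous_ofReal.continuousAt.tendsto.mono_left nhdsWithin_le_nhds) ?_
    filter_upwards [self_mem_nhdsWithin] with σ hσ
    simpa only [mem_compl_iff, mem_singleton_iff, Complex.ofReal_inj] using hσ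
  exact AnalyticOnNhd.eqOn_of_preconnected_of_frequently_eq h1 h2 hconv.isPreconnected
    (z₀ := ((a + 1 : ℝ) : ℂ)) (by simp only [mem_setOf_eq, Complex.ofReal_re]; linarith)
    (ht.frequently hreal) (by simp)

lemma final_aux (r : ℕ)
    (A : Matrix (Fin r) (Fin r) ℝ) (hA : A.det ≠ 0) (x y : Fin r → ℝ)
    (hx : ∀ ν, x ν ∈ Set.Ioo (0 : ℝ) 1) (hy : ∀ ν, y ν ∈ Set.Ioo (0 : ℝ) 1)
    (G : (Fin r → ℂ) → ℂ) (hG : Differentiable ℂ G)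
    (hGL : ∀ s : Fin r → ℂ, (∀ ν, 0 < (s ν).re) → G s = ShintaniL s A x y)
    (k : Fin r → ℕ) :
    G (fun ν => -(k ν : ℂ)) = BkNum A x y k := by
  have hf : MClass A (fun t => FF (Matrix.vecMul t A) x y) :=
    MClass.prod (fun μ t => phiF t (x μ) (y μ)) (fun μ => phiF_EClass _ _ (hx μ) (hy μ))
  unfold BkNum
  generalize hfd : (fun t : Fin r → ℝ => FF (Matrix.vecMul t A) x y) = f at hf ⊢
  have hh := hf.pderMulti hA k
  have hg := hh.pderMulti hA (fun _ => 1)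
  obtain ⟨C, c, hc, hb⟩ := hg.bound hA
  set h := pderMulti k f with hhd
  set g := pderMulti (fun _ => 1) h with hgd
  have h2pi : (2 * (Real.pi : ℂ)) ≠ 0 := by simp [Real.pi_ne_zero]
  have key := eq_one_of_real_eq (H := fun z => G (fun ν => z - ((k ν : ℂ) + 1)))
    (R := fun z => (∏ ν, (2 * (Real.pi : ℂ)) ^ (z - ((k ν : ℂ) + 1))) *
      ((-1) ^ (∑ ν, k ν) * ((-1) ^ (∑ _ν : Fin r, 1) * ((Complex.Gamma z)⁻¹ ^ r * Kint g z))))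
    (hG.comp (by fun_prop)) ?_ ((∑ ν, (k ν : ℝ)) + 1) (by positivity) ?_
  · have h1 := Jint_eq_Kint g 1 one_pos
    have h0 := Jint_multi hA hh (fun _ => 0) (fun _ => le_rfl) (fun _ => 1)
    simp only [Nat.cast_one, zero_add] at h0
    rw [Complex.ofReal_one] at h1
    simp only [← h1] at key
    rw [← h0, Jint_zero] at key
    simp only [sub_add_cancel_right] at key
    rw [key]
    have : ∏ ν, (2 * (Real.pi : ℂ)) ^ (-(k ν : ℂ)) = ((2 * (Real.pi : ℂ)) ^ (∑ ν, k ν))⁻¹ := by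
      simp only [Complex.cpow_neg, Complex.cpow_natCast, Finset.prod_inv_distrib,
        Finset.prod_pow_eq_pow_sum]
    rw [this, neg_mul, neg_pow (2 * (Real.pi : ℂ)), mul_inv, ← inv_pow]
    have : ((-1 : ℂ))⁻¹ = -1 := by norm_num
    rw [← inv_pow, this]
    ring
  · intro z hz
    have hK := Kint_differentiableAt hg.continuous hc hb z hz
    have hΓ : DifferentiableAt ℂ (fun z => (Complex.Gamma z)⁻¹) z :=
      Complex.differentiable_one_div_Gamma z
    have hP : DifferentiableAt ℂ (fun z : ℂ => ∏ ν, (2 * (Real.pi : ℂ)) ^ (z - ((k ν : ℂ) + 1))) z := by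
      refine DifferentiableAt.fun_finsetProd fun ν _ => ?_
      exact DifferentiableAt.const_cpow (by fun_prop) (Or.inl h2pi)
    exact hP.mul ((((hΓ.pow r).mul hK).const_mul _).const_mul _)
  · intro σ hσ
    have hk : ∀ ν, (k ν : ℝ) + 1 < σ := fun ν => by
      have := Finset.single_le_sum (f := fun ν => (k ν : ℝ)) (fun i _ => Nat.cast_nonneg _)
        (Finset.mem_univ ν)
      linarith
    have hσ0 : 0 < σ := by
      have : (0 : ℝ) ≤ ∑ ν, (k ν : ℝ) := by positivity
      linarith
    have hs : ∀ ν, 0 < σ - ((k ν : ℝ) + 1) := fun ν => by linarith [hk ν]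
    have e : (fun ν => (σ : ℂ) - ((k ν : ℂ) + 1)) = fun ν => ((σ - ((k ν : ℝ) + 1) : ℝ) : ℂ) := by
      funext ν; push_cast; ring
    have e1 : Jint h (fun ν => σ - ((k ν : ℝ) + 1) + k ν) = Jint h (fun _ => σ - 1) := by
      congr 1; funext ν; ring
    have e2 := Jint_multi hA hh (fun _ => σ - 1) (fun ν => by
      have : (0 : ℝ) ≤ ∑ ν, (k ν : ℝ) := by positivity
      linarith) (fun _ => 1)
    simp only [Nat.cast_one, sub_add_cancel] at e2
    rw [← Jint_eq_Kint g σ hσ0, ← e2, ← e1, ← Jint_multi hA hf _ (fun ν => (hs ν).le) k, e,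
      hGL _ (fun ν => by simpa only [Complex.ofReal_re] using hs ν), ShintaniL_eq_Jint A x y _ hs, hfd]
    congr 1
    refine Finset.prod_congr rfl fun ν _ => ?_
    rw [congrFun e ν]

end ShintaniHelpers

theorem stmt_18 (r : ℕ) (hr : 1 ≤ r)
    (A : Matrix (Fin r) (Fin r) ℝ) (hA : A.det ≠ 0) (x y : Fin r → ℝ)
    (hx : ∀ ν, x ν ∈ Set.Ioo (0 : ℝ) 1) (hy : ∀ ν, y ν ∈ Set.Ioo (0 : ℝ) 1)
    (G : (Fin r → ℂ) → ℂ) (hG : Differentiable ℂ G)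
    (hGL : ∀ s : Fin r → ℂ, (∀ ν, 0 < (s ν).re) → G s = ShintaniL s A x y)
    (k : Fin r → ℕ) :
    G (fun ν => -(k ν : ℂ)) = BkNum A x y k := by
  exact final_aux r A hA x y hx hy G hG hGL k

end
end

section
/- Let r ≥ 1, A ∈ GL_r(ℝ), and x, y ∈ (0,1)^r. Then the function ℝ^r → ℂ, t ↦ F(tA, x, y), is a Schwartz function (i.e., it is smooth and all of its derivatives decay faster than any inverse power of |t|). -/
open MeasureTheory

noncomputable section

theorem aux_lower (a : ℂ) (ha : ‖a‖ = 1) (u : ℝ) (hu : 0 ≤ u) :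
    ‖1 - a‖ / 2 * (1 + u) ≤ ‖1 - a * u‖ := by
  have h1 : a.re ^ 2 + a.im ^ 2 = 1 := by
    have := Complex.sq_norm a
    rw [ha, Complex.normSq_apply] at this
    nlinarith
  have hs : (‖1 - a‖ / 2 * (1 + u)) ^ 2 ≤ ‖1 - a * u‖ ^ 2 := by
    rw [mul_pow, div_pow, Complex.sq_norm, Complex.sq_norm, Complex.normSq_apply,
      Complex.normSq_apply]
    simp only [Complex.sub_re, Complex.sub_im, Complex.mul_re, Complex.mul_im, Complex.one_re,
      Complex.one_im, Complex.ofReal_re, Complex.ofReal_im]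
    have h2 : 0 ≤ 1 + a.re := by nlinarith [sq_nonneg a.im]
    have h3 := mul_nonneg h2 (sq_nonneg (1 - u))
    have e1 : a.im ^ 2 = 1 - a.re ^ 2 := by linarith
    ring_nf
    rw [e1]
    nlinarith
  exact le_of_sq_le_sq hs (norm_nonneg _)

/-- The auxiliary family closed under differentiation. -/
def psi (a : ℂ) (c : ℝ) (n : ℕ) (t : ℝ) : ℂ :=
  Complex.exp (((-2 * Real.pi * c * t : ℝ)) : ℂ) *
    ((1 - a * Complex.exp (((-2 * Real.pi * t : ℝ)) : ℂ)) ^ n)⁻¹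

theorem aux_ne (a : ℂ) (ha : ‖a‖ = 1) (ha1 : a ≠ 1) (t : ℝ) :
    1 - a * Complex.exp (((-2 * Real.pi * t : ℝ)) : ℂ) ≠ 0 := by
  have h := aux_lower a ha (Real.exp (-2 * Real.pi * t)) (Real.exp_pos _).le
  rw [Complex.ofReal_exp] at h
  have : 0 < ‖1 - a‖ := norm_pos_iff.2 (sub_ne_zero.2 (Ne.symm ha1))
  have h2 : 0 < ‖1 - a‖ / 2 * (1 + Real.exp (-2 * Real.pi * t)) := by positivity
  exact norm_pos_iff.1 (h2.trans_le h)

theorem psi_contDiff (a : ℂ) (ha : ‖a‖ = 1) (ha1 : a ≠ 1) (c : ℝ) (n : ℕ) (m : WithTop ℕ∞) :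
    ContDiff ℝ m (psi a c n) := by
  unfold psi
  have hE : ∀ c : ℝ, ContDiff ℝ m (fun t : ℝ => Complex.exp (((-2 * Real.pi * c * t : ℝ)) : ℂ)) := by
    intro c
    refine ContDiff.cexp ?_
    exact Complex.ofRealCLM.contDiff.comp (contDiff_const.mul contDiff_id)
  have h1 := hE 1
  simp only [mul_one] at h1
  refine (hE c).mul (ContDiff.inv ((contDiff_const.sub (contDiff_const.mul h1)).pow n) ?_)
  intro t
  exact pow_ne_zero _ (aux_ne a ha ha1 t)

theorem psi_deriv (a : ℂ) (ha : ‖a‖ = 1) (ha1 : a ≠ 1) (c : ℝ) (n : ℕ) :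
    deriv (psi a c n) = (fun t => (-2 * Real.pi * c : ℂ) * psi a c n t) +
      (fun t => (-2 * Real.pi * n * a : ℂ) * psi a (c + 1) (n + 1) t) := by
  funext t
  have hE : ∀ c : ℝ, HasDerivAt (fun t : ℝ => Complex.exp (((-2 * Real.pi * c * t : ℝ)) : ℂ))
      (Complex.exp (((-2 * Real.pi * c * t : ℝ)) : ℂ) * ((-2 * Real.pi * c : ℝ) : ℂ)) t := by
    intro c
    refine HasDerivAt.cexp ?_
    have := ((hasDerivAt_id t).const_mul (-2 * Real.pi * c)).ofReal_comp
    simpa using this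
  have h1 := hE 1
  simp only [mul_one] at h1
  have hne := aux_ne a ha ha1 t
  have h2 := (((h1.const_mul a).const_sub 1).pow n).inv (pow_ne_zero n hne)
  have h3 := (hE c).mul h2
  have h4 : deriv (psi a c n) t = _ := h3.deriv
  rw [h4]
  simp only [Pi.add_apply, psi, Pi.pow_apply, Pi.inv_apply]
  have e : Complex.exp (((-2 * Real.pi * (c + 1) * t : ℝ)) : ℂ) =
      Complex.exp (((-2 * Real.pi * c * t : ℝ)) : ℂ) * Complex.exp (((-2 * Real.pi * t : ℝ)) : ℂ) := by
    rw [← Complex.exp_add]; congr 1; push_cast; ring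
  rw [e]
  generalize Complex.exp (((-2 * Real.pi * c * t : ℝ)) : ℂ) = X
  generalize Complex.exp (((-2 * Real.pi * t : ℝ)) : ℂ) = U at *
  push_cast
  rcases n with _ | n
  · simp; ring
  · simp only [Nat.add_sub_cancel]
    field_simp
    push_cast
    ring

theorem aux_exp (b : ℝ) (hb : 0 < b) (k : ℕ) (s : ℝ) (hs : 0 ≤ s) :
    s ^ k * Real.exp (-(b * s)) ≤ k.factorial / b ^ k := by
  have h := Real.pow_div_factorial_le_exp (b * s) (by positivity) k
  rw [Real.exp_neg, ← div_eq_mul_inv, div_le_div_iff₀ (Real.exp_pos _) (by positivity)]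
  rw [div_le_iff₀ (by positivity)] at h
  rw [mul_pow] at h
  linarith

theorem psi_bound0 (a : ℂ) (ha : ‖a‖ = 1) (ha1 : a ≠ 1) (c : ℝ) (n : ℕ) (hc : 0 < c) (hcn : c < n)
    (k : ℕ) : ∃ C, ∀ t : ℝ, |t| ^ k * ‖psi a c n t‖ ≤ C := by
  have hd : 0 < ‖1 - a‖ := norm_pos_iff.2 (sub_ne_zero.2 (Ne.symm ha1))
  set δ := ‖1 - a‖ / 2 with hδ
  have hδ0 : 0 < δ := by positivity
  set b := 2 * Real.pi * min c (n - c) with hb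
  have hb0 : 0 < b := by
    have : 0 < min c (n - c) := lt_min hc (by linarith)
    have := Real.pi_pos
    positivity
  refine ⟨(δ ^ n)⁻¹ * (k.factorial / b ^ k), fun t => ?_⟩
  have key : ‖psi a c n t‖ ≤ (δ ^ n)⁻¹ * Real.exp (-(b * |t|)) := by
    set u := Real.exp (-2 * Real.pi * t) with hu
    have hu0 : 0 < u := Real.exp_pos _
    have h := aux_lower a ha u hu0.le
    rw [hu, Complex.ofReal_exp, ← hu] at h
    have hp := pow_le_pow_left₀ (by positivity) h n
    rw [psi, norm_mul, norm_inv, norm_pow, Complex.norm_exp_ofReal]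
    have h1 : (‖1 - a * Complex.exp (((-2 * Real.pi * t : ℝ)) : ℂ)‖ ^ n)⁻¹ ≤
        (δ ^ n)⁻¹ * ((1 + u) ^ n)⁻¹ := by
      rw [← mul_inv, ← mul_pow]
      exact inv_anti₀ (by positivity) hp
    have h2 : Real.exp (-2 * Real.pi * c * t) * ((1 + u) ^ n)⁻¹ ≤ Real.exp (-(b * |t|)) := by
      rcases le_total 0 t with ht | ht
      · have : ((1 + u) ^ n)⁻¹ ≤ 1 := inv_le_one_of_one_le₀ (one_le_pow₀ (by linarith))
        calc _ ≤ Real.exp (-2 * Real.pi * c * t) * 1 := by gcongr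
          _ ≤ _ := by
            rw [mul_one, abs_of_nonneg ht]
            apply Real.exp_le_exp.2
            have : b ≤ 2 * Real.pi * c := by
              rw [hb]; gcongr; exact min_le_left _ _
            nlinarith
      · have : ((1 + u) ^ n)⁻¹ ≤ Real.exp (n * (2 * Real.pi * t)) := by
          have : Real.exp (n * (2 * Real.pi * t)) = (u ^ n)⁻¹ := by
            rw [hu, ← Real.exp_nat_mul, ← Real.exp_neg]; congr 1; ring
          rw [this]
          apply inv_anti₀ (by positivity)
          gcongr; linarith
        calc _ ≤ Real.exp (-2 * Real.pi * c * t) * Real.exp (n * (2 * Real.pi * t)) := by gcongr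
          _ ≤ _ := by
            rw [← Real.exp_add, abs_of_nonpos ht]
            apply Real.exp_le_exp.2
            have : b ≤ 2 * Real.pi * (n - c) := by
              rw [hb]; gcongr; exact min_le_right _ _
            nlinarith
    calc _ ≤ Real.exp (-2 * Real.pi * c * t) * ((δ ^ n)⁻¹ * ((1 + u) ^ n)⁻¹) := by gcongr
      _ = (δ ^ n)⁻¹ * (Real.exp (-2 * Real.pi * c * t) * ((1 + u) ^ n)⁻¹) := by ring
      _ ≤ _ := by gcongr
  calc _ ≤ |t| ^ k * ((δ ^ n)⁻¹ * Real.exp (-(b * |t|))) := by gcongr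
    _ = (δ ^ n)⁻¹ * (|t| ^ k * Real.exp (-(b * |t|))) := by ring
    _ ≤ _ := by gcongr; exact aux_exp b hb0 k _ (abs_nonneg t)

theorem psi_bound (a : ℂ) (ha : ‖a‖ = 1) (ha1 : a ≠ 1) (k m : ℕ) :
    ∀ (c : ℝ) (n : ℕ), 0 < c → c < n →
    ∃ C, ∀ t : ℝ, |t| ^ k * ‖iteratedDeriv m (psi a c n) t‖ ≤ C := by
  induction m with
  | zero =>
    intro c n hc hcn
    simpa using psi_bound0 a ha ha1 c n hc hcn k
  | succ m ih =>
    intro c n hc hcn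
    obtain ⟨C1, h1⟩ := ih c n hc hcn
    obtain ⟨C2, h2⟩ := ih (c + 1) (n + 1) (by linarith) (by push_cast; linarith)
    refine ⟨‖(-2 * Real.pi * c : ℂ)‖ * C1 + ‖(-2 * Real.pi * n * a : ℂ)‖ * C2, fun t => ?_⟩
    have s1 := (psi_contDiff a ha ha1 c n m).contDiffAt (x := t)
    have s2 := (psi_contDiff a ha ha1 (c + 1) (n + 1) m).contDiffAt (x := t)
    rw [iteratedDeriv_succ', psi_deriv a ha ha1,
      iteratedDeriv_add (contDiffAt_const.mul s1) (contDiffAt_const.mul s2),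
      iteratedDeriv_const_mul_field, iteratedDeriv_const_mul_field]
    have h1 := h1 t
    have h2 := h2 t
    calc _ ≤ |t| ^ k * (‖(-2 * Real.pi * c : ℂ)‖ * ‖iteratedDeriv m (psi a c n) t‖ +
          ‖(-2 * Real.pi * n * a : ℂ)‖ * ‖iteratedDeriv m (psi a (c + 1) (n + 1)) t‖) := by
          gcongr
          refine (norm_add_le _ _).trans ?_
          exact (congrArg₂ (· + ·) (norm_mul _ _) (norm_mul _ _)).le
      _ = ‖(-2 * Real.pi * c : ℂ)‖ * (|t| ^ k * ‖iteratedDeriv m (psi a c n) t‖) +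
          ‖(-2 * Real.pi * n * a : ℂ)‖ *
            (|t| ^ k * ‖iteratedDeriv m (psi a (c + 1) (n + 1)) t‖) := by ring
      _ ≤ _ := by gcongr

theorem phi_schwartz (x y : ℝ) (hx : x ∈ Set.Ioo (0 : ℝ) 1) (hy : y ∈ Set.Ioo (0 : ℝ) 1) :
    ∃ f : SchwartzMap ℝ ℂ, ∀ t, f t = phiF t x y := by
  set a : ℂ := eC y with hadef
  have ha : ‖a‖ = 1 := by
    have : a = Complex.exp ((2 * Real.pi * y : ℝ) * Complex.I) := by
      rw [hadef, eC]; congr 1; push_cast; ring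
    rw [this, Complex.norm_exp_ofReal_mul_I]
  have ha1 : a ≠ 1 := by
    intro h
    rw [hadef, eC, Complex.exp_eq_one_iff] at h
    obtain ⟨n, hn⟩ := h
    have h2 : (2 * Real.pi * Complex.I) * ((y : ℂ) - n) = 0 := by rw [mul_sub, hn]; ring
    have h3 := (mul_eq_zero.1 h2).resolve_left Complex.two_pi_I_ne_zero
    have h4 : y = n := by exact_mod_cast sub_eq_zero.1 h3
    obtain ⟨h5, h6⟩ := hy
    rw [h4] at h5 h6
    have : (0 : ℤ) < n := by exact_mod_cast h5
    have : n < (1 : ℤ) := by exact_mod_cast h6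
    omega
  refine ⟨⟨psi a x 1, psi_contDiff a ha ha1 x 1 _, fun k m => ?_⟩, fun t => ?_⟩
  · obtain ⟨C, hC⟩ := psi_bound a ha ha1 k m x 1 hx.1 (by simpa using hx.2)
    refine ⟨C, fun t => ?_⟩
    rw [norm_iteratedFDeriv_eq_norm_iteratedDeriv]
    exact hC t
  · change psi a x 1 t = _
    have e1 : eC (Complex.I * t * x) = Complex.exp (((-2 * Real.pi * x * t : ℝ)) : ℂ) := by
      rw [eC]; congr 1; push_cast; linear_combination (2 * Real.pi * t * x : ℂ) * Complex.I_mul_I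
    have e2 : eC (y + Complex.I * t) = a * Complex.exp (((-2 * Real.pi * t : ℝ)) : ℂ) := by
      rw [hadef, eC, eC, ← Complex.exp_add]; congr 1; push_cast
      linear_combination (2 * Real.pi * t : ℂ) * Complex.I_mul_I
    rw [phiF, psi, e1, e2, pow_one, div_eq_mul_inv]

theorem comp_proj_bound {r : ℕ} (f : SchwartzMap ℝ ℂ) (i : Fin r) (m : ℕ) (t : Fin r → ℝ) :
    ‖iteratedFDeriv ℝ m (fun t : Fin r → ℝ => f (t i)) t‖ ≤ ‖iteratedFDeriv ℝ m f (t i)‖ := by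
  let P : (Fin r → ℝ) →L[ℝ] ℝ := ContinuousLinearMap.proj i
  have hP : ‖P‖ ≤ 1 := by
    refine ContinuousLinearMap.opNorm_le_bound _ zero_le_one fun v => ?_
    rw [one_mul]
    exact norm_le_pi_norm v i
  have h : iteratedFDeriv ℝ m (f ∘ P) t = _ :=
    ContinuousLinearMap.iteratedFDeriv_comp_right P (f.smooth m) t le_rfl
  change ‖iteratedFDeriv ℝ m (f ∘ P) t‖ ≤ _
  rw [h]
  refine (ContinuousMultilinearMap.norm_compContinuousLinearMap_le _ _).trans ?_
  refine mul_le_of_le_one_right (norm_nonneg _) ?_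
  exact Finset.prod_le_one (fun _ _ => norm_nonneg _) (fun _ _ => hP)

theorem one_add_bound (f : SchwartzMap ℝ ℂ) (k m : ℕ) :
    ∃ C, 0 ≤ C ∧ ∀ s : ℝ, (1 + |s|) ^ k * ‖iteratedFDeriv ℝ m f s‖ ≤ C := by
  refine ⟨_, ?_, fun s => SchwartzMap.one_add_le_sup_seminorm_apply (𝕜 := ℝ) (m := (k, m)) le_rfl le_rfl f s⟩
  positivity

theorem prod_schwartz {r : ℕ} (f : Fin r → SchwartzMap ℝ ℂ) :
    ∃ Φ : SchwartzMap (Fin r → ℝ) ℂ, ∀ t, Φ t = ∏ i, f i (t i) := by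
  have hsm : ∀ (N : ℕ∞) (i : Fin r), ContDiff ℝ N (fun t : Fin r → ℝ => f i (t i)) := fun N i =>
    ((f i).smooth N).comp (contDiff_apply ℝ ℝ i)
  refine ⟨⟨fun t => ∏ i, f i (t i), contDiff_prod fun i _ => hsm _ i, fun k n => ?_⟩, fun t => rfl⟩
  choose C hC0 hC using fun (i : Fin r) (m : ℕ) => one_add_bound (f i) k m
  refine ⟨∑ p ∈ (Finset.univ : Finset (Fin r)).sym n, ((p : Multiset (Fin r)).countPerms : ℝ) *
    ∏ j, C j (Multiset.count j (p : Multiset (Fin r))), fun t => ?_⟩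
  have h := norm_iteratedFDeriv_prod_le (𝕜 := ℝ) (u := Finset.univ) (N := n)
    (f := fun i (t : Fin r → ℝ) => f i (t i)) (fun i _ => hsm n i) (x := t) (n := n) le_rfl
  have ht : ‖t‖ ≤ ∏ i, (1 + |t i|) := by
    refine (pi_norm_le_iff_of_nonneg (Finset.prod_nonneg fun i _ => by positivity)).2 fun i => ?_
    calc ‖t i‖ ≤ 1 + |t i| := by rw [Real.norm_eq_abs]; linarith
      _ ≤ _ := by
        rw [← Finset.mul_prod_erase Finset.univ (fun i => 1 + |t i|) (Finset.mem_univ i)]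
        refine le_mul_of_one_le_right (by positivity) ?_
        have h1 : ∏ j ∈ Finset.univ.erase i, (1 : ℝ) ≤ ∏ j ∈ Finset.univ.erase i, (1 + |t j|) :=
          Finset.prod_le_prod (fun _ _ => zero_le_one) (fun j _ => by linarith [abs_nonneg (t j)])
        simpa using h1
  have htk : ‖t‖ ^ k ≤ ∏ i, (1 + |t i|) ^ k := by
    rw [Finset.prod_pow]
    exact pow_le_pow_left₀ (norm_nonneg _) ht k
  refine (mul_le_mul htk h (norm_nonneg _) (Finset.prod_nonneg fun i _ => by positivity)).trans ?_
  rw [Finset.mul_sum]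
  refine Finset.sum_le_sum fun p _ => ?_
  rw [mul_left_comm, ← Finset.prod_mul_distrib]
  gcongr with i _
  refine le_trans ?_ (hC i _ (t i))
  gcongr
  exact comp_proj_bound (f i) i _ t

theorem stmt_19 (r : ℕ) (hr : 1 ≤ r)
    (A : Matrix (Fin r) (Fin r) ℝ) (hA : A.det ≠ 0) (x y : Fin r → ℝ)
    (hx : ∀ ν, x ν ∈ Set.Ioo (0 : ℝ) 1) (hy : ∀ ν, y ν ∈ Set.Ioo (0 : ℝ) 1) :
    ∃ Φ : SchwartzMap (Fin r → ℝ) ℂ,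
      ∀ t : Fin r → ℝ, Φ t = FF (Matrix.vecMul t A) x y := by
  choose f hf using fun ν => phi_schwartz (x ν) (y ν) (hx ν) (hy ν)
  obtain ⟨Ψ, hΨ⟩ := prod_schwartz f
  have hu : IsUnit A.det := isUnit_iff_ne_zero.2 hA
  let L : (Fin r → ℝ) ≃ₗ[ℝ] (Fin r → ℝ) :=
    LinearEquiv.ofLinearMap (Matrix.vecMulLinear A) (Matrix.vecMulLinear A⁻¹)
      (by
        refine LinearMap.ext fun v => ?_
        simp [Matrix.vecMul_vecMul, Matrix.nonsing_inv_mul _ hu])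
      (by
        refine LinearMap.ext fun v => ?_
        simp [Matrix.vecMul_vecMul, Matrix.mul_nonsing_inv _ hu])
  refine ⟨SchwartzMap.compCLMOfContinuousLinearEquiv ℝ L.toContinuousLinearEquiv Ψ, fun t => ?_⟩
  rw [SchwartzMap.compCLMOfContinuousLinearEquiv_apply]
  change Ψ (Matrix.vecMul t A) = _
  rw [hΨ, FF]
  exact Finset.prod_congr rfl fun ν _ => hf ν _

end
end
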